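/- Let n ≥ 1, 1 ≤ k < n, H : ℝⁿ × ℝⁿ → ℝ smooth, and ψᵃᵢ : ℝⁿ → ℝ smooth (a = 1,…,k; i = 1,…,n). With Ψᵃ(q,p) = Σᵢψᵃᵢ(q)(∂H/∂pᵢ)(q,p), Cᵃᵇ(q,p) = Σ_{i,j}ψᵃᵢ(q)ψᵇⱼ(q)(∂²H/∂pᵢ∂pⱼ)(q,p), and X_{H,M} = X_H − Σ_{a,b}C_{ab}(X_HΨᵇ)Zᵃ as in the nonholonomic Hamilton–Jacobi setting, let σ : ℝⁿ → ℝⁿ be smooth with Ψᵃ(q,σ(q)) = 0 for all a, q, with (Cᵃᵇ(q,σ(q))) invertible for all q, and with ⟨Dσ(q)v,w⟩ = ⟨Dσ(q)w,v⟩ whenever v, w annihilate all constraints at q (dσ ∈ I(N°)). Assume moreover that the constraint distribution N_q = {v : Σᵢψᵃᵢ(q)vᵢ = 0 ∀a} is completely nonholonomic: there exist smooth vector fields Y₁,…,Y_r : ℝⁿ → ℝⁿ with Σᵢψᵃᵢ(q)Yⁱ_b(q) = 0 for all a, b, q, spanning N_q at every q, whose iterated Lie brackets span ℝⁿ at every point.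 Then X^σ(q) = ∇_pH(q,σ(q)) and X_{H,M} are σ-related if and only if d(H∘σ) = 0, i.e. the function q ↦ H(q, σ(q)) has identically vanishing derivative on ℝⁿ. -/

import Mathlib

noncomputable section

def Hq (n : ℕ) (H : (Fin n → ℝ) × (Fin n → ℝ) → ℝ) (i : Fin n)
    (w : (Fin n → ℝ) × (Fin n → ℝ)) : ℝ :=
  fderiv ℝ H w (Pi.single i 1, (0 : Fin n → ℝ))

def Hp (n : ℕ) (H : (Fin n → ℝ) × (Fin n → ℝ) → ℝ) (i : Fin n)
    (w : (Fin n → ℝ) × (Fin n → ℝ)) : ℝ :=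
  fderiv ℝ H w ((0 : Fin n → ℝ), Pi.single i 1)

/-- Momentum constraints `Ψᵃ(q,p) = Σᵢ ψᵃᵢ(q)(∂H/∂pᵢ)(q,p)`. -/
def Psi (n k : ℕ) (H : (Fin n → ℝ) × (Fin n → ℝ) → ℝ)
    (ψc : Fin k → Fin n → (Fin n → ℝ) → ℝ) (a : Fin k)
    (w : (Fin n → ℝ) × (Fin n → ℝ)) : ℝ :=
  ∑ i, ψc a i w.1 * Hp n H i w

/-- `Cᵃᵇ(q,p) = Σ_{i,j} ψᵃᵢ(q)ψᵇⱼ(q)(∂²H/∂pᵢ∂pⱼ)(q,p)`. -/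
def Cmat (n k : ℕ) (H : (Fin n → ℝ) × (Fin n → ℝ) → ℝ)
    (ψc : Fin k → Fin n → (Fin n → ℝ) → ℝ)
    (w : (Fin n → ℝ) × (Fin n → ℝ)) : Matrix (Fin k) (Fin k) ℝ :=
  fun a b => ∑ i, ∑ j, ψc a i w.1 * ψc b j w.1 *
    fderiv ℝ (fun w' => Hp n H j w') w ((0 : Fin n → ℝ), Pi.single i 1)

def XHPsi (n k : ℕ) (H : (Fin n → ℝ) × (Fin n → ℝ) → ℝ)
    (ψc : Fin k → Fin n → (Fin n → ℝ) → ℝ) (b : Fin k)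
    (w : (Fin n → ℝ) × (Fin n → ℝ)) : ℝ :=
  ∑ i, (Hp n H i w * fderiv ℝ (Psi n k H ψc b) w (Pi.single i 1, (0 : Fin n → ℝ)) -
        Hq n H i w * fderiv ℝ (Psi n k H ψc b) w ((0 : Fin n → ℝ), Pi.single i 1))

/-- The `p`-component of `X_{H,M} = X_H − Σ_{a,b} C_{ab}·(X_HΨᵇ)·Zᵃ`. -/
def XHMp (n k : ℕ) (H : (Fin n → ℝ) × (Fin n → ℝ) → ℝ)
    (ψc : Fin k → Fin n → (Fin n → ℝ) → ℝ)
    (w : (Fin n → ℝ) × (Fin n → ℝ)) : Fin n → ℝ :=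
  fun i => - Hq n H i w -
    ∑ a, ∑ b, (Cmat n k H ψc w)⁻¹ a b * XHPsi n k H ψc b w * ψc a i w.1

/-- Lie bracket of vector fields on `ℝⁿ`. -/
def vbracket (n : ℕ) (X Y : (Fin n → ℝ) → (Fin n → ℝ)) :
    (Fin n → ℝ) → (Fin n → ℝ) :=
  fun q => fderiv ℝ Y q (X q) - fderiv ℝ X q (Y q)

/-- Iterated bracket families of a finite family of vector fields. -/
def brkFam (n r : ℕ) (X : Fin r → (Fin n → ℝ) → (Fin n → ℝ)) :
    ℕ → Set ((Fin n → ℝ) → (Fin n → ℝ))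
  | 0 => Set.range X
  | j + 1 => brkFam n r X j ∪
      {Z | ∃ A ∈ brkFam n r X j, ∃ B ∈ brkFam n r X j, Z = vbracket n A B}

theorem clm_prod_pi_apply {n : ℕ} (L : (Fin n → ℝ) × (Fin n → ℝ) →L[ℝ] ℝ) (a b : Fin n → ℝ) :
    L (a, b) = ∑ i, (a i * L (Pi.single i 1, (0 : Fin n → ℝ)) +
      b i * L ((0 : Fin n → ℝ), Pi.single i 1)) := by
  have key : (a, b) = ∑ i, (a i • ((Pi.single i 1, 0) : (Fin n → ℝ) × (Fin n → ℝ)) +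
      b i • ((0, Pi.single i 1) : (Fin n → ℝ) × (Fin n → ℝ))) := by
    ext j <;> simp [Prod.fst_sum, Prod.snd_sum, Finset.sum_apply, Pi.single_apply]
  conv_lhs => rw [key]
  simp only [map_sum, map_add, map_smul, smul_eq_mul]

theorem contDiff_Hp {n : ℕ} {H : (Fin n → ℝ) × (Fin n → ℝ) → ℝ}
    (hH : ContDiff ℝ (⊤ : ℕ∞) H) (i : Fin n) : ContDiff ℝ (⊤ : ℕ∞) (Hp n H i) :=
  (hH.fderiv_right (m := (⊤ : ℕ∞)) (by simp)).clm_apply contDiff_const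

theorem fderiv_Hp_symm {n : ℕ} {H : (Fin n → ℝ) × (Fin n → ℝ) → ℝ}
    (hH : ContDiff ℝ (⊤ : ℕ∞) H) (i j : Fin n) (w : (Fin n → ℝ) × (Fin n → ℝ)) :
    fderiv ℝ (Hp n H j) w ((0 : Fin n → ℝ), Pi.single i 1) =
      fderiv ℝ (Hp n H i) w ((0 : Fin n → ℝ), Pi.single j 1) := by
  have hd : DifferentiableAt ℝ (fderiv ℝ H) w :=
    ((hH.fderiv_right (m := (⊤ : ℕ∞)) (by simp)).differentiable (by simp)) w
  have h (l : Fin n) (v : (Fin n → ℝ) × (Fin n → ℝ)) :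
      fderiv ℝ (Hp n H l) w v = fderiv ℝ (fderiv ℝ H) w v ((0 : Fin n → ℝ), Pi.single l 1) := by
    unfold Hp
    rw [fderiv_clm_apply hd (differentiableAt_const _)]
    simp
  rw [h, h]
  exact (hH.contDiffAt.isSymmSndFDerivAt
      (by simpa using WithTop.coe_le_coe.2 (le_top (a := (2 : ℕ∞))))) _ _

theorem contDiff_Psi {n k : ℕ} {H : (Fin n → ℝ) × (Fin n → ℝ) → ℝ}
    (hH : ContDiff ℝ (⊤ : ℕ∞) H) {ψc : Fin k → Fin n → (Fin n → ℝ) → ℝ}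
    (hψc : ∀ a i, ContDiff ℝ (⊤ : ℕ∞) (ψc a i)) (a : Fin k) :
    ContDiff ℝ (⊤ : ℕ∞) (Psi n k H ψc a) :=
  ContDiff.sum fun i _ => ((hψc a i).comp contDiff_fst).mul (contDiff_Hp hH i)

theorem fderiv_Psi_momentum {n k : ℕ} {H : (Fin n → ℝ) × (Fin n → ℝ) → ℝ}
    (hH : ContDiff ℝ (⊤ : ℕ∞) H) {ψc : Fin k → Fin n → (Fin n → ℝ) → ℝ}
    (hψc : ∀ a i, ContDiff ℝ (⊤ : ℕ∞) (ψc a i)) (b : Fin k)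
    (w : (Fin n → ℝ) × (Fin n → ℝ)) (v : Fin n → ℝ) :
    fderiv ℝ (Psi n k H ψc b) w ((0 : Fin n → ℝ), v) =
      ∑ j, ψc b j w.1 * fderiv ℝ (Hp n H j) w ((0 : Fin n → ℝ), v) := by
  have h (j : Fin n) : HasFDerivAt (fun w : (Fin n → ℝ) × (Fin n → ℝ) => ψc b j w.1 * Hp n H j w)
      (ψc b j w.1 • fderiv ℝ (Hp n H j) w +
        Hp n H j w • (fderiv ℝ (ψc b j) w.1).comp (ContinuousLinearMap.fst ℝ _ _)) w :=
    (((hψc b j).differentiable (by simp) w.1).hasFDerivAt.comp w hasFDerivAt_fst).mul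
      ((contDiff_Hp hH j).differentiable (by simp) w).hasFDerivAt
  have hs := (HasFDerivAt.fun_sum fun j (_ : j ∈ Finset.univ) => h j).fderiv
  change fderiv ℝ (Psi n k H ψc b) w = _ at hs
  rw [hs]
  simp

theorem Cmat_apply {n k : ℕ} {H : (Fin n → ℝ) × (Fin n → ℝ) → ℝ}
    (hH : ContDiff ℝ (⊤ : ℕ∞) H) {ψc : Fin k → Fin n → (Fin n → ℝ) → ℝ}
    (hψc : ∀ a i, ContDiff ℝ (⊤ : ℕ∞) (ψc a i)) (w : (Fin n → ℝ) × (Fin n → ℝ)) (a b : Fin k) :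
    Cmat n k H ψc w a b =
      ∑ i, ψc a i w.1 * fderiv ℝ (Psi n k H ψc b) w ((0 : Fin n → ℝ), Pi.single i 1) := by
  simp only [Cmat, fderiv_Psi_momentum hH hψc, Finset.mul_sum, mul_assoc]

theorem Cmat_symm {n k : ℕ} {H : (Fin n → ℝ) × (Fin n → ℝ) → ℝ}
    (hH : ContDiff ℝ (⊤ : ℕ∞) H) (ψc : Fin k → Fin n → (Fin n → ℝ) → ℝ)
    (w : (Fin n → ℝ) × (Fin n → ℝ)) (a b : Fin k) :
    Cmat n k H ψc w a b = Cmat n k H ψc w b a := by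
  simp only [Cmat]
  rw [Finset.sum_comm]
  refine Finset.sum_congr rfl fun i _ => Finset.sum_congr rfl fun j _ => ?_
  rw [fderiv_Hp_symm hH j i w]
  ring

/-- A covector annihilating the common kernel of finitely many covectors is a combination of
them. -/
theorem exists_eq_sum_of_annihilates {n k : ℕ} (A : Fin k → Fin n → ℝ) (u : Fin n → ℝ)
    (h : ∀ v : Fin n → ℝ, (∀ a, ∑ i, A a i * v i = 0) → ∑ i, u i * v i = 0) :
    ∃ c : Fin k → ℝ, ∀ i, u i = ∑ a, c a * A a i := by
  let e := dotProductEquiv ℝ (Fin n)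
  have hmem : e u ∈ Submodule.span ℝ (Set.range fun a => e (A a)) := by
    refine mem_span_of_iInf_ker_le_ker fun v hv => ?_
    simp only [Submodule.mem_iInf, LinearMap.mem_ker] at hv ⊢
    exact h v hv
  obtain ⟨c, hc⟩ := (Submodule.mem_span_range_iff_exists_fun ℝ).1 hmem
  refine ⟨c, fun i => ?_⟩
  have : e (∑ a, c a • A a) = e u := by simpa [map_sum] using hc
  have := congrFun (e.injective this) i
  simpa [Finset.sum_apply] using this.symm

theorem contDiff_of_mem_brkFam {n r : ℕ} {Y : Fin r → (Fin n → ℝ) → (Fin n → ℝ)}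
    (hY : ∀ b, ContDiff ℝ (⊤ : ℕ∞) (Y b)) {j : ℕ} {Z : (Fin n → ℝ) → (Fin n → ℝ)}
    (hZ : Z ∈ brkFam n r Y j) : ContDiff ℝ (⊤ : ℕ∞) Z := by
  induction j generalizing Z with
  | zero =>
    obtain ⟨b, rfl⟩ := hZ
    exact hY b
  | succ j ih =>
    rcases hZ with hZ | ⟨A, hA, B, hB, rfl⟩
    · exact ih hZ
    · exact (((ih hB).fderiv_right (m := (⊤ : ℕ∞)) (by simp)).clm_apply (ih hA)).sub
        (((ih hA).fderiv_right (m := (⊤ : ℕ∞)) (by simp)).clm_apply (ih hB))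

theorem fderiv_vbracket_eq_zero {n : ℕ} {h : (Fin n → ℝ) → ℝ} (hh : ContDiff ℝ (⊤ : ℕ∞) h)
    {A B : (Fin n → ℝ) → (Fin n → ℝ)} (hA : Differentiable ℝ A) (hB : Differentiable ℝ B)
    (hA0 : ∀ q, fderiv ℝ h q (A q) = 0) (hB0 : ∀ q, fderiv ℝ h q (B q) = 0) (q : Fin n → ℝ) :
    fderiv ℝ h q (vbracket n A B q) = 0 := by
  have hd : DifferentiableAt ℝ (fderiv ℝ h) q :=
    ((hh.fderiv_right (m := (⊤ : ℕ∞)) (by simp)).differentiable (by simp)) q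
  have key {Z : (Fin n → ℝ) → (Fin n → ℝ)} (hZ : Differentiable ℝ Z)
      (hZ0 : ∀ q, fderiv ℝ h q (Z q) = 0) (v : Fin n → ℝ) :
      fderiv ℝ h q (fderiv ℝ Z q v) + fderiv ℝ (fderiv ℝ h) q v (Z q) = 0 := by
    have hz : fderiv ℝ (fun q => fderiv ℝ h q (Z q)) q v = 0 := by simp [hZ0]
    rw [fderiv_clm_apply hd (hZ q)] at hz
    simpa using hz
  have hsymm : fderiv ℝ (fderiv ℝ h) q (A q) (B q) = fderiv ℝ (fderiv ℝ h) q (B q) (A q) :=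
    (hh.contDiffAt.isSymmSndFDerivAt
      (by simpa using WithTop.coe_le_coe.2 (le_top (a := (2 : ℕ∞))))) _ _
  have h1 := key hB hB0 (A q)
  have h2 := key hA hA0 (B q)
  rw [vbracket, map_sub]
  linarith

theorem fderiv_apply_eq_zero_of_mem_brkFam {n r : ℕ} {h : (Fin n → ℝ) → ℝ}
    (hh : ContDiff ℝ (⊤ : ℕ∞) h) {Y : Fin r → (Fin n → ℝ) → (Fin n → ℝ)}
    (hY : ∀ b, ContDiff ℝ (⊤ : ℕ∞) (Y b)) (hY0 : ∀ b q, fderiv ℝ h q (Y b q) = 0)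
    {j : ℕ} {Z : (Fin n → ℝ) → (Fin n → ℝ)} (hZ : Z ∈ brkFam n r Y j) (q : Fin n → ℝ) :
    fderiv ℝ h q (Z q) = 0 := by
  induction j generalizing Z q with
  | zero =>
    obtain ⟨b, rfl⟩ := hZ
    exact hY0 b q
  | succ j ih =>
    rcases hZ with hZ | ⟨A, hA, B, hB, rfl⟩
    · exact ih hZ q
    · exact fderiv_vbracket_eq_zero hh
        ((contDiff_of_mem_brkFam hY hA).differentiable (by simp))
        ((contDiff_of_mem_brkFam hY hB).differentiable (by simp)) (ih hA) (ih hB) q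

theorem fderiv_comp_graph {n : ℕ} {f : (Fin n → ℝ) × (Fin n → ℝ) → ℝ} (hf : Differentiable ℝ f)
    {σ : (Fin n → ℝ) → (Fin n → ℝ)} (hσ : Differentiable ℝ σ) (q v : Fin n → ℝ) :
    fderiv ℝ (fun q => f (q, σ q)) q v =
      ∑ i, (v i * fderiv ℝ f (q, σ q) (Pi.single i 1, (0 : Fin n → ℝ)) +
        fderiv ℝ σ q v i * fderiv ℝ f (q, σ q) ((0 : Fin n → ℝ), Pi.single i 1)) := by
  have h : HasFDerivAt (fun q => f (q, σ q)) _ q :=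
    (hf (q, σ q)).hasFDerivAt.comp q ((hasFDerivAt_id q).prodMk (hσ q).hasFDerivAt)
  rw [h.fderiv, ← clm_prod_pi_apply]
  rfl

/-- `σ`-relatedness at `q` holds iff `Dσ(q)X^σ(q) + ∂H/∂q` is a combination of the constraint
covectors at `q`. -/
theorem related_iff_exists_multipliers {n k : ℕ} {H : (Fin n → ℝ) × (Fin n → ℝ) → ℝ}
    (hH : ContDiff ℝ (⊤ : ℕ∞) H) {ψc : Fin k → Fin n → (Fin n → ℝ) → ℝ}
    (hψc : ∀ a i, ContDiff ℝ (⊤ : ℕ∞) (ψc a i)) {σ : (Fin n → ℝ) → (Fin n → ℝ)}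
    (hσ : Differentiable ℝ σ) (hM : ∀ (a : Fin k) (q : Fin n → ℝ), Psi n k H ψc a (q, σ q) = 0)
    (q : Fin n → ℝ) (hC : IsUnit (Cmat n k H ψc (q, σ q))) :
    fderiv ℝ σ q (fun i => Hp n H i (q, σ q)) = XHMp n k H ψc (q, σ q) ↔
      ∃ c : Fin k → ℝ, ∀ i, fderiv ℝ σ q (fun i => Hp n H i (q, σ q)) i + Hq n H i (q, σ q) =
        ∑ a, c a * ψc a i q := by
  set w := (q, σ q) with hw
  set D := fderiv ℝ σ q (fun i => Hp n H i w) with hD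
  have hX (b : Fin k) : XHPsi n k H ψc b w = - ∑ i, (D i + Hq n H i w) *
      fderiv ℝ (Psi n k H ψc b) w ((0 : Fin n → ℝ), Pi.single i 1) := by
    have h0 := fderiv_comp_graph ((contDiff_Psi hH hψc b).differentiable (by simp)) hσ q
      (fun i => Hp n H i w)
    simp only [hM, fderiv_fun_const, Pi.zero_apply, zero_apply, ← hw, ← hD,
      Finset.sum_add_distrib] at h0
    simp only [XHPsi, add_mul, Finset.sum_add_distrib, Finset.sum_sub_distrib]
    linarith
  constructor
  · intro h
    refine ⟨fun a => - ∑ b, (Cmat n k H ψc w)⁻¹ a b * XHPsi n k H ψc b w, fun i => ?_⟩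
    rw [h, XHMp]
    simp only [neg_mul, Finset.sum_neg_distrib, Finset.sum_mul]
    ring
  · rintro ⟨c, hc⟩
    have hXc (b : Fin k) : XHPsi n k H ψc b w = - (Cmat n k H ψc w).mulVec c b := by
      rw [hX]
      simp only [hc, Matrix.mulVec, dotProduct, Cmat_symm hH ψc w b, Cmat_apply hH hψc,
        Finset.sum_mul]
      rw [Finset.sum_comm]
      refine congrArg _ (Finset.sum_congr rfl fun a _ => Finset.sum_congr rfl fun i _ => ?_)
      ring
    have hinv (a : Fin k) :
        ∑ b, (Cmat n k H ψc w)⁻¹ a b * (Cmat n k H ψc w).mulVec c b = c a := by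
      change (Cmat n k H ψc w)⁻¹.mulVec ((Cmat n k H ψc w).mulVec c) a = c a
      rw [Matrix.mulVec_mulVec,
        Matrix.nonsing_inv_mul _ ((Matrix.isUnit_iff_isUnit_det _).1 hC), Matrix.one_mulVec]
    ext i
    simp only [XHMp, hXc, mul_neg, neg_mul, Finset.sum_neg_distrib, ← Finset.sum_mul, hinv]
    linarith [hc i]

/-- **Nonholonomic Hamilton–Jacobi theorem, completely nonholonomic case.**
If in addition the constraint distribution is completely nonholonomic
(bracket-generating), then `σ`-relatedness is equivalent to `d(H∘σ) = 0`. -/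
theorem stmt_17 (n k : ℕ) (hn : 1 ≤ n) (hk : 1 ≤ k) (hkn : k < n)
    (H : (Fin n → ℝ) × (Fin n → ℝ) → ℝ) (hH : ContDiff ℝ (⊤ : ℕ∞) H)
    (ψc : Fin k → Fin n → (Fin n → ℝ) → ℝ) (hψc : ∀ a i, ContDiff ℝ (⊤ : ℕ∞) (ψc a i))
    (σ : (Fin n → ℝ) → (Fin n → ℝ)) (hσ : ContDiff ℝ (⊤ : ℕ∞) σ)
    (hM : ∀ (a : Fin k) (q : Fin n → ℝ), Psi n k H ψc a (q, σ q) = 0)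
    (hcomp : ∀ q : Fin n → ℝ, IsUnit (Cmat n k H ψc (q, σ q)))
    (hdσ : ∀ (q v w : Fin n → ℝ),
      (∀ a, ∑ i, ψc a i q * v i = 0) → (∀ a, ∑ i, ψc a i q * w i = 0) →
      ∑ i, fderiv ℝ σ q v i * w i = ∑ i, fderiv ℝ σ q w i * v i)
    (r : ℕ) (Y : Fin r → (Fin n → ℝ) → (Fin n → ℝ))
    (hYsmooth : ∀ b, ContDiff ℝ (⊤ : ℕ∞) (Y b))
    (hYtangent : ∀ (a : Fin k) (b : Fin r) (q : Fin n → ℝ),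
      ∑ i, ψc a i q * Y b q i = 0)
    (hYspan : ∀ (q v : Fin n → ℝ), (∀ a, ∑ i, ψc a i q * v i = 0) →
      v ∈ Submodule.span ℝ (Set.range fun b => Y b q))
    (hbg : ∀ q : Fin n → ℝ,
      Submodule.span ℝ {v : Fin n → ℝ | ∃ j, ∃ Z ∈ brkFam n r Y j, v = Z q} = ⊤) :
    (∀ q : Fin n → ℝ,
        fderiv ℝ σ q (fun i => Hp n H i (q, σ q)) = XHMp n k H ψc (q, σ q)) ↔
    (∀ q : Fin n → ℝ, fderiv ℝ (fun q' => H (q', σ q')) q = 0) := by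
  have hσd : Differentiable ℝ σ := hσ.differentiable (by simp)
  have hdh (q v : Fin n → ℝ) (hv : ∀ a, ∑ i, ψc a i q * v i = 0) :
      fderiv ℝ (fun q' => H (q', σ q')) q v =
        ∑ i, (fderiv ℝ σ q (fun i => Hp n H i (q, σ q)) i + Hq n H i (q, σ q)) * v i := by
    have h1 := fderiv_comp_graph (hH.differentiable (by simp)) hσd q v
    have h2 := hdσ q v (fun i => Hp n H i (q, σ q)) hv fun a => hM a q
    rw [h1]
    simp only [add_mul, Finset.sum_add_distrib, ← h2]
    rw [add_comm]
    congr 1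
    exact Finset.sum_congr rfl fun i _ => mul_comm _ _
  constructor
  · intro hrel q
    have hY0 (b : Fin r) (q : Fin n → ℝ) :
        fderiv ℝ (fun q' => H (q', σ q')) q (Y b q) = 0 := by
      obtain ⟨c, hc⟩ :=
        (related_iff_exists_multipliers hH hψc hσd hM q (hcomp q)).1 (hrel q)
      rw [hdh q (Y b q) fun a => hYtangent a b q]
      simp only [hc, Finset.sum_mul]
      rw [Finset.sum_comm]
      refine Finset.sum_eq_zero fun a _ => ?_
      simp only [mul_assoc, ← Finset.mul_sum, hYtangent, mul_zero]
    have hh : ContDiff ℝ (⊤ : ℕ∞) (fun q' => H (q', σ q')) := hH.comp (contDiff_id.prodMk hσ)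
    have hle : Submodule.span ℝ {v : Fin n → ℝ | ∃ j, ∃ Z ∈ brkFam n r Y j, v = Z q} ≤
        LinearMap.ker (fderiv ℝ (fun q' => H (q', σ q')) q).toLinearMap := by
      rw [Submodule.span_le]
      rintro _ ⟨j, Z, hZ, rfl⟩
      exact fderiv_apply_eq_zero_of_mem_brkFam hh hYsmooth hY0 hZ q
    rw [hbg q] at hle
    exact ContinuousLinearMap.ext fun v => hle (Submodule.mem_top (x := v))
  · intro h0 q
    refine (related_iff_exists_multipliers hH hψc hσd hM q (hcomp q)).2
      (exists_eq_sum_of_annihilates (fun a i => ψc a i q) _ fun v hv => ?_)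
    rw [← hdh q v hv, h0 q]
    rfl
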